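/- arXiv:2210.14549 — 11 statements merged into one kernel-verified Lean document; each statement's English description precedes it below -/
import Mathlib

section
/- Let C be a binary linear [n,k] code with generator matrix G (rows r₁,…,r_k linearly independent) and h(C) = ℓ. Let x ∈ GF(2)^n satisfy x·x = 1, and set y_i = x·r_i. Then the (k+1)×(n+2) matrix G₁ whose first row is (1, 0, x₁, …, x_n) and whose (i+1)-st row is (y_i, y_i, r_i) for 1 ≤ i ≤ k has linearly independent rows, so the code C₁ it generates is a binary [n+2, k+1] code, and h(C₁) = ℓ + 1. -/
open Matrix

/-- The dual code of a binary linear code `C ⊆ GF(2)^n`. -/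
def dualCode {n : ℕ} (C : Submodule (ZMod 2) (Fin n → ZMod 2)) :
    Submodule (ZMod 2) (Fin n → ZMod 2) where
  carrier := {v | ∀ c ∈ C, v ⬝ᵥ c = 0}
  add_mem' := by
    intro a b ha hb c hc
    simp only [Set.mem_setOf_eq] at *
    rw [add_dotProduct, ha c hc, hb c hc, add_zero]
  zero_mem' := by
    intro c hc
    simp
  smul_mem' := by
    intro a v hv c hc
    simp only [Set.mem_setOf_eq] at *
    rw [smul_dotProduct, hv c hc, smul_zero]

/-- The hull of a binary linear code: `Hull(C) = C ∩ C⊥`. -/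
def hull {n : ℕ} (C : Submodule (ZMod 2) (Fin n → ZMod 2)) :
    Submodule (ZMod 2) (Fin n → ZMod 2) := C ⊓ dualCode C

/-- The isometric embedding `c ↦ (x ⬝ᵥ c, x ⬝ᵥ c, c)` of binary vectors. -/
def doubledParityEmbedding {n : ℕ} (x : Fin n → ZMod 2) :
    (Fin n → ZMod 2) →ₗ[ZMod 2] (Fin (n + 2) → ZMod 2) where
  toFun c := vecCons (x ⬝ᵥ c) (vecCons (x ⬝ᵥ c) c)
  map_add' a b := by simp [dotProduct_add]
  map_smul' a b := by simp [dotProduct_smul]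

theorem doubledParityEmbedding_apply {n : ℕ} (x c : Fin n → ZMod 2) :
    doubledParityEmbedding x c = vecCons (x ⬝ᵥ c) (vecCons (x ⬝ᵥ c) c) := rfl

theorem doubledParityEmbedding_injective {n : ℕ} (x : Fin n → ZMod 2) :
    Function.Injective (doubledParityEmbedding x) := fun a b h => by
  simp only [doubledParityEmbedding_apply, vecCons_inj] at h
  exact h.2.2

theorem doubledParityEmbedding_dotProduct {n : ℕ} (x c d : Fin n → ZMod 2) :
    doubledParityEmbedding x c ⬝ᵥ doubledParityEmbedding x d = c ⬝ᵥ d := by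
  simp only [doubledParityEmbedding_apply, cons_dotProduct_cons]
  rw [← add_assoc, CharTwo.add_self_eq_zero, zero_add]

theorem cons_one_zero_dotProduct_self {n : ℕ} {x : Fin n → ZMod 2} (hx : x ⬝ᵥ x = 1) :
    vecCons 1 (vecCons 0 x) ⬝ᵥ vecCons 1 (vecCons 0 x) = 0 := by
  simp only [cons_dotProduct_cons, hx]
  decide

theorem cons_one_zero_dotProduct_doubledParityEmbedding {n : ℕ} (x c : Fin n → ZMod 2) :
    vecCons 1 (vecCons 0 x) ⬝ᵥ doubledParityEmbedding x c = 0 := by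
  simp only [doubledParityEmbedding_apply, cons_dotProduct_cons, one_mul, zero_mul, zero_add]
  exact CharTwo.add_self_eq_zero _

theorem cons_one_zero_notMem_map {n : ℕ} (x : Fin n → ZMod 2)
    (D : Submodule (ZMod 2) (Fin n → ZMod 2)) :
    vecCons 1 (vecCons 0 x) ∉ D.map (doubledParityEmbedding x) := by
  rintro ⟨c, -, hc⟩
  simp only [doubledParityEmbedding_apply, vecCons_inj] at hc
  exact one_ne_zero (hc.1.symm.trans hc.2.1)

theorem finrank_span_cons_one_zero_sup_map {n : ℕ} (x : Fin n → ZMod 2)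
    (D : Submodule (ZMod 2) (Fin n → ZMod 2)) :
    Module.finrank (ZMod 2) ↥(Submodule.span (ZMod 2) {vecCons 1 (vecCons 0 x)} ⊔
      D.map (doubledParityEmbedding x)) = Module.finrank (ZMod 2) D + 1 := by
  have hu : vecCons (1 : ZMod 2) (vecCons 0 x) ≠ 0 := fun h => one_ne_zero (congrFun h 0)
  have hdisj := (Submodule.disjoint_span_singleton' hu).2 (cons_one_zero_notMem_map x D)
  have h := Submodule.finrank_sup_add_finrank_inf_eq
    (Submodule.span (ZMod 2) {vecCons 1 (vecCons 0 x)}) (D.map (doubledParityEmbedding x))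
  rwa [hdisj.symm.eq_bot, finrank_bot, add_zero, finrank_span_singleton hu,
    (Submodule.equivMapOfInjective _ (doubledParityEmbedding_injective x) D).finrank_eq.symm,
    add_comm] at h

theorem hull_span_cons_one_zero_sup_map {n : ℕ} {x : Fin n → ZMod 2} (hx : x ⬝ᵥ x = 1)
    (C : Submodule (ZMod 2) (Fin n → ZMod 2)) :
    hull (Submodule.span (ZMod 2) {vecCons 1 (vecCons 0 x)} ⊔
        C.map (doubledParityEmbedding x)) =
      Submodule.span (ZMod 2) {vecCons 1 (vecCons 0 x)} ⊔
        (hull C).map (doubledParityEmbedding x) := by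
  have huu := cons_one_zero_dotProduct_self hx
  have hue := cons_one_zero_dotProduct_doubledParityEmbedding x
  generalize vecCons (1 : ZMod 2) (vecCons 0 x) = u at *
  have heu : ∀ c, doubledParityEmbedding x c ⬝ᵥ u = 0 := fun c => by rw [dotProduct_comm, hue]
  ext v
  constructor
  · rintro ⟨hv, hv'⟩
    obtain ⟨_, ha, _, ⟨c, hc, rfl⟩, rfl⟩ := Submodule.mem_sup.1 hv
    refine Submodule.add_mem_sup ha ⟨c, ⟨hc, fun d hd => ?_⟩, rfl⟩
    obtain ⟨a, rfl⟩ := Submodule.mem_span_singleton.1 ha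
    have := hv' _ (Submodule.mem_sup_right ⟨d, hd, rfl⟩)
    simpa [add_dotProduct, hue, doubledParityEmbedding_dotProduct] using this
  · intro hv
    refine ⟨(sup_le_sup_left (Submodule.map_mono inf_le_left) _ : _ ≤ _ ⊔ C.map _) hv,
      fun w hw => ?_⟩
    obtain ⟨_, ha, _, ⟨c, hc, rfl⟩, rfl⟩ := Submodule.mem_sup.1 hv
    obtain ⟨_, hb, _, ⟨d, hd, rfl⟩, rfl⟩ := Submodule.mem_sup.1 hw
    obtain ⟨a, rfl⟩ := Submodule.mem_span_singleton.1 ha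
    obtain ⟨b, rfl⟩ := Submodule.mem_span_singleton.1 hb
    simp [add_dotProduct, dotProduct_add, huu, hue, heu, doubledParityEmbedding_dotProduct,
      hc.2 d hd]

/-- Construction I: from a binary `[n,k]` code with hull dimension `ℓ`
and a vector `x` with `x ⬝ᵥ x = 1`, the matrix `G₁` with first row `(1,0,x)` and rows
`(yᵢ, yᵢ, rᵢ)` has linearly independent rows, generating an `[n+2, k+1]` code `C₁`
with `h(C₁) = ℓ + 1`. -/
theorem constructionI_hull {n k ℓ : ℕ}
    (G : Matrix (Fin k) (Fin n) (ZMod 2))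
    (hG : LinearIndependent (ZMod 2) (fun i => G i))
    (C : Submodule (ZMod 2) (Fin n → ZMod 2))
    (hC : C = Submodule.span (ZMod 2) (Set.range fun i => G i))
    (hℓ : Module.finrank (ZMod 2) ↥(hull C) = ℓ)
    (x : Fin n → ZMod 2) (hx : x ⬝ᵥ x = 1)
    (G₁ : Matrix (Fin (k + 1)) (Fin (n + 2)) (ZMod 2))
    (hG₁ : G₁ = Matrix.of (Fin.cons (Fin.cons 1 (Fin.cons 0 x))
      (fun i => Fin.cons (x ⬝ᵥ G i) (Fin.cons (x ⬝ᵥ G i) (G i)))))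
    (C₁ : Submodule (ZMod 2) (Fin (n + 2) → ZMod 2))
    (hC₁ : C₁ = Submodule.span (ZMod 2) (Set.range fun i => G₁ i)) :
    LinearIndependent (ZMod 2) (fun i => G₁ i) ∧
      Module.finrank (ZMod 2) ↥C₁ = k + 1 ∧
      Module.finrank (ZMod 2) ↥(hull C₁) = ℓ + 1 := by
  have hspan : C₁ = Submodule.span (ZMod 2) {vecCons 1 (vecCons 0 x)} ⊔
      C.map (doubledParityEmbedding x) := by
    have hrows : (fun i => G₁ i) = Fin.cons (vecCons 1 (vecCons 0 x))
        (fun i => doubledParityEmbedding x (G i)) := by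
      rw [hG₁]; rfl
    rw [hC₁, hrows, Fin.range_cons, Submodule.span_insert, hC, Submodule.map_span,
      ← Set.range_comp]
    rfl
  have hrank : Module.finrank (ZMod 2) ↥C₁ = k + 1 := by
    rw [hspan, finrank_span_cons_one_zero_sup_map, hC, finrank_span_eq_card hG, Fintype.card_fin]
  refine ⟨?_, hrank, ?_⟩
  · rw [linearIndependent_iff_card_eq_finrank_span, Set.finrank, ← hC₁, hrank, Fintype.card_fin]
  · rw [hspan, hull_span_cons_one_zero_sup_map hx, finrank_span_cons_one_zero_sup_map, hℓ]
end

section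
/- Let G be a k×n matrix over GF(2) with rows r₁,…,r_k and let x ∈ GF(2)^n satisfy x·x = 1. Set y_i = x·r_i and let G₁ be the (k+1)×(n+2) matrix whose first row is (1, 0, x₁, …, x_n) and whose (i+1)-st row is (y_i, y_i, r_i). Then G₁·G₁ᵀ is the block matrix whose first row and first column are zero and whose remaining k×k block is G·Gᵀ; in particular rank(G₁·G₁ᵀ) = rank(G·Gᵀ). -/
open Matrix

/-- Bordering a square matrix by a zero first row and a zero first column preserves its rank. -/
theorem rank_of_cons_zero_cons_zero {R : Type*} [CommRing R] [Nontrivial R] {k : ℕ}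
    (A : Matrix (Fin k) (Fin k) R) :
    (Matrix.of (Fin.cons (0 : Fin (k + 1) → R) (fun i => Fin.cons 0 (A i))) :
      Matrix (Fin (k + 1)) (Fin (k + 1)) R).rank = A.rank := by
  set P : Matrix (Fin k) (Fin (k + 1)) R := (1 : Matrix _ _ R).submatrix Fin.succ id with hP
  set B : Matrix (Fin (k + 1)) (Fin (k + 1)) R :=
    Matrix.of (Fin.cons (0 : Fin (k + 1) → R) (fun i => Fin.cons 0 (A i))) with hB
  have hBA : B = Pᵀ * A * P := by
    ext i j
    refine Fin.cases ?_ (fun i => ?_) i <;> refine Fin.cases ?_ (fun j => ?_) j <;>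
      simp [hP, hB, Matrix.mul_apply, Matrix.one_apply,
        fun a : Fin k => (Fin.succ_ne_zero a).symm]
  apply le_antisymm
  · rw [hBA]
    exact (rank_mul_le_left _ _).trans (rank_mul_le_right _ _)
  · exact rank_submatrix_le B Fin.succ Fin.succ

/-- For the Construction I matrix `G₁` built from `G` and a vector `x`
with `x ⬝ᵥ x = 1`, the matrix `G₁ * G₁ᵀ` is the block matrix whose first row and
first column are zero and whose remaining `k × k` block is `G * Gᵀ`; in particular
`rank (G₁ * G₁ᵀ) = rank (G * Gᵀ)`. -/
theorem constructionI_gram {n k : ℕ}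
    (G : Matrix (Fin k) (Fin n) (ZMod 2))
    (x : Fin n → ZMod 2) (hx : x ⬝ᵥ x = 1)
    (G₁ : Matrix (Fin (k + 1)) (Fin (n + 2)) (ZMod 2))
    (hG₁ : G₁ = Matrix.of (Fin.cons (Fin.cons 1 (Fin.cons 0 x))
      (fun i => Fin.cons (x ⬝ᵥ G i) (Fin.cons (x ⬝ᵥ G i) (G i))))) :
    G₁ * G₁ᵀ = Matrix.of (Fin.cons (0 : Fin (k + 1) → ZMod 2)
        (fun i => Fin.cons 0 ((G * Gᵀ) i))) ∧
      (G₁ * G₁ᵀ).rank = (G * Gᵀ).rank := by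
  have hgram : G₁ * G₁ᵀ = Matrix.of (Fin.cons (0 : Fin (k + 1) → ZMod 2)
      (fun i => Fin.cons 0 ((G * Gᵀ) i))) := by
    have hxx : ∑ l, x l * x l = 1 := hx
    subst hG₁
    ext i j
    refine Fin.cases ?_ (fun i => ?_) i <;> refine Fin.cases ?_ (fun j => ?_) j <;>
      simp [Matrix.mul_apply, Fin.sum_univ_succ, dotProduct, hxx, ← add_assoc,
        CharTwo.add_self_eq_zero, mul_comm]
  exact ⟨hgram, by rw [hgram, rank_of_cons_zero_cons_zero]⟩
end

section
/- Let C be a binary linear [n,k] code with generator matrix G (rows r₁,…,r_k) and parity check matrix H (rows s₁,…,s_{n−k}, a generator matrix of C⊥). Let x ∈ GF(2)^n satisfy x·x = 1, set y_i = x·r_i and z_j = x·s_j. Let G₁ be the (k+1)×(n+2) matrix with first row (1, 0, x₁, …, x_n) and (i+1)-st row (y_i, y_i, r_i), generating the code C₁, and let H₁ be the (n−k+1)×(n+2) matrix with first row (1, 0, x₁, …, x_n) and (j+1)-st row (z_j, z_j, s_j). Then H₁ is a parity check matrix for C₁, i.e., the row space of H₁ equals C₁⊥. -/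
open Matrix

theorem mem_dualCode_span_range {n : ℕ} {ι : Type*} (g : ι → Fin n → ZMod 2)
    (v : Fin n → ZMod 2) :
    v ∈ dualCode (Submodule.span (ZMod 2) (Set.range g)) ↔ ∀ i, v ⬝ᵥ g i = 0 := by
  refine ⟨fun h i => h _ (Submodule.subset_span ⟨i, rfl⟩), fun h c hc => ?_⟩
  induction hc using Submodule.span_induction with
  | mem c hc =>
    obtain ⟨i, rfl⟩ := hc
    exact h i
  | zero => exact dotProduct_zero v
  | add a b _ _ ha hb => rw [dotProduct_add, ha, hb, add_zero]
  | smul r a _ ha => rw [dotProduct_smul, ha, smul_zero]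

/-- The linear map `s ↦ (x ⬝ᵥ s, x ⬝ᵥ s, s)` that extends the rows in Construction I. -/
def constructionIExtend {n : ℕ} (x : Fin n → ZMod 2) :
    (Fin n → ZMod 2) →ₗ[ZMod 2] (Fin (n + 2) → ZMod 2) where
  toFun s := Fin.cons (x ⬝ᵥ s) (Fin.cons (x ⬝ᵥ s) s)
  map_add' s t := by
    funext i
    refine Fin.cases ?_ (Fin.cases ?_ fun i => ?_) i <;> simp [dotProduct_add]
  map_smul' r s := by
    funext i
    refine Fin.cases ?_ (Fin.cases ?_ fun i => ?_) i <;> simp [dotProduct_smul]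

theorem mem_span_range_constructionI {n m : ℕ} (x : Fin n → ZMod 2)
    (H : Fin m → Fin n → ZMod 2) (e w : Fin (n + 2) → ZMod 2) :
    w ∈ Submodule.span (ZMod 2) (Set.range (Fin.cons e
        (fun j => Fin.cons (x ⬝ᵥ H j) (Fin.cons (x ⬝ᵥ H j) (H j))) :
          Fin (m + 1) → Fin (n + 2) → ZMod 2)) ↔
      ∃ c : ZMod 2, ∃ s ∈ Submodule.span (ZMod 2) (Set.range H),
        w = c • e + constructionIExtend x s := by
  have hrows : (fun j => Fin.cons (x ⬝ᵥ H j) (Fin.cons (x ⬝ᵥ H j) (H j)) :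
      Fin m → Fin (n + 2) → ZMod 2) = constructionIExtend x ∘ H := rfl
  rw [hrows, Fin.range_cons, Set.range_comp, Submodule.mem_span_insert, Submodule.span_image]
  simp only [Submodule.mem_map, exists_exists_and_eq_and]

theorem dotProduct_fin_cons_cons {n : ℕ} (a b c d : ZMod 2) (v u : Fin n → ZMod 2) :
    (Fin.cons a (Fin.cons b v) : Fin (n + 2) → ZMod 2) ⬝ᵥ
      (Fin.cons c (Fin.cons d u) : Fin (n + 2) → ZMod 2) = a * c + (b * d + v ⬝ᵥ u) := by
  simp [dotProduct, Fin.sum_univ_succ]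

theorem mem_dualCode_constructionI {n k : ℕ} (x : Fin n → ZMod 2)
    (G : Fin k → Fin n → ZMod 2) (a b : ZMod 2) (v : Fin n → ZMod 2) :
    (Fin.cons a (Fin.cons b v) : Fin (n + 2) → ZMod 2) ∈
        dualCode (Submodule.span (ZMod 2) (Set.range (Fin.cons (Fin.cons 1 (Fin.cons 0 x))
          (fun i => Fin.cons (x ⬝ᵥ G i) (Fin.cons (x ⬝ᵥ G i) (G i))) :
            Fin (k + 1) → Fin (n + 2) → ZMod 2))) ↔
      a + v ⬝ᵥ x = 0 ∧ ∀ i, (a + b) * x ⬝ᵥ G i + v ⬝ᵥ G i = 0 := by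
  simp only [mem_dualCode_span_range, Fin.forall_fin_succ, Fin.cons_zero, Fin.cons_succ,
    dotProduct_fin_cons_cons, mul_one, mul_zero, zero_add, add_mul, add_assoc]

/-- For Construction I applied to a binary `[n,k]` code `C` with
generator matrix `G`, parity check matrix `H`, and `x` with `x ⬝ᵥ x = 1`, the matrix
`H₁` with first row `(1,0,x)` and rows `(z_j, z_j, s_j)` is a parity check matrix for
the code `C₁` generated by `G₁`, i.e. the row space of `H₁` equals `C₁⊥`. -/
theorem constructionI_parityCheck {n k : ℕ}
    (G : Matrix (Fin k) (Fin n) (ZMod 2))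
    (hG : LinearIndependent (ZMod 2) (fun i => G i))
    (H : Matrix (Fin (n - k)) (Fin n) (ZMod 2))
    (hH : LinearIndependent (ZMod 2) (fun j => H j))
    (C : Submodule (ZMod 2) (Fin n → ZMod 2))
    (hC : C = Submodule.span (ZMod 2) (Set.range fun i => G i))
    (hHdual : Submodule.span (ZMod 2) (Set.range fun j => H j) = dualCode C)
    (x : Fin n → ZMod 2) (hx : x ⬝ᵥ x = 1)
    (G₁ : Matrix (Fin (k + 1)) (Fin (n + 2)) (ZMod 2))
    (hG₁ : G₁ = Matrix.of (Fin.cons (Fin.cons 1 (Fin.cons 0 x))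
      (fun i => Fin.cons (x ⬝ᵥ G i) (Fin.cons (x ⬝ᵥ G i) (G i)))))
    (C₁ : Submodule (ZMod 2) (Fin (n + 2) → ZMod 2))
    (hC₁ : C₁ = Submodule.span (ZMod 2) (Set.range fun i => G₁ i))
    (H₁ : Matrix (Fin (n - k + 1)) (Fin (n + 2)) (ZMod 2))
    (hH₁ : H₁ = Matrix.of (Fin.cons (Fin.cons 1 (Fin.cons 0 x))
      (fun j => Fin.cons (x ⬝ᵥ H j) (Fin.cons (x ⬝ᵥ H j) (H j))))) :
    Submodule.span (ZMod 2) (Set.range fun j => H₁ j) = dualCode C₁ := by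
  subst hC hG₁ hC₁ hH₁
  ext w
  refine Fin.consCases (fun a w => ?_) w
  refine Fin.consCases (fun b v => ?_) w
  refine (mem_span_range_constructionI x (fun j => H j) _ _).trans <|
    Iff.trans ?_ (mem_dualCode_constructionI x (fun i => G i) a b v).symm
  have hdual (s : Fin n → ZMod 2) :
      s ∈ Submodule.span (ZMod 2) (Set.range fun j => H j) ↔ ∀ i, s ⬝ᵥ G i = 0 := by
    rw [hHdual]
    exact mem_dualCode_span_range _ s
  simp only [hdual]
  have two : (2 : ZMod 2) = 0 := rfl
  constructor
  · rintro ⟨c, s, hs, hw⟩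
    have ha := congrFun hw 0
    have hb := congrFun hw 1
    have hv : v = c • x + s := funext fun i => congrFun hw i.succ.succ
    change a = c * 1 + x ⬝ᵥ s at ha
    change b = c * 0 + x ⬝ᵥ s at hb
    subst ha hb hv
    simp only [add_dotProduct, smul_dotProduct, smul_eq_mul, hx, hs, dotProduct_comm s x]
    exact ⟨by linear_combination (c + x ⬝ᵥ s) * two,
      fun i => by linear_combination (c * x ⬝ᵥ G i + x ⬝ᵥ s * x ⬝ᵥ G i) * two⟩
  · rintro ⟨h₀, h⟩
    refine ⟨a + b, v + (a + b) • x, fun i => ?_, ?_⟩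
    · rw [add_dotProduct, smul_dotProduct, smul_eq_mul]
      linear_combination h i
    · have hs : x ⬝ᵥ (v + (a + b) • x) = b := by
        rw [dotProduct_add, dotProduct_smul, smul_eq_mul, hx, dotProduct_comm]
        linear_combination h₀
      funext i
      refine Fin.cases ?_ (Fin.cases ?_ fun i => ?_) i
      · change a = (a + b) * 1 + x ⬝ᵥ (v + (a + b) • x)
        rw [hs]
        linear_combination -b * two
      · change b = (a + b) * 0 + x ⬝ᵥ (v + (a + b) • x)
        rw [hs]
        ring
      · change v i = (a + b) * x i + (v i + (a + b) * x i)
        linear_combination -(a + b) * x i * two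
end

section
/- Let C be a binary linear [n,k] code with generator matrix G (rows r₁,…,r_k linearly independent) and h(C) = ℓ. Let x ∈ GF(2)^n satisfy x·x = 0, set y_i = x·r_i, and suppose y_i = 0 for all 1 ≤ i ≤ k. Then the (k+1)×(n+2) matrix G₂ whose first row is (1, 1, x₁, …, x_n) and whose (i+1)-st row is (y_i, 0, r_i) has linearly independent rows, so the code C₂ it generates is a binary [n+2, k+1] code, and h(C₂) = ℓ + 1. -/
open Matrix

/-- Padding a vector with two leading zeros. -/
def padZeros (n : ℕ) : (Fin n → ZMod 2) →ₗ[ZMod 2] (Fin (n + 2) → ZMod 2) where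
  toFun v := Fin.cons 0 (Fin.cons 0 v)
  map_add' u v := by
    ext i
    refine Fin.cases ?_ (fun i => Fin.cases ?_ (fun i => ?_) i) i <;> simp
  map_smul' a v := by
    ext i
    refine Fin.cases ?_ (fun i => Fin.cases ?_ (fun i => ?_) i) i <;> simp

lemma padZeros_apply {n : ℕ} (v : Fin n → ZMod 2) :
    padZeros n v = Fin.cons 0 (Fin.cons 0 v) := rfl

/-- The map `(a, v) ↦ a • (1, 1, x) + (0, 0, v)`. -/
def extendByRow {n : ℕ} (x : Fin n → ZMod 2) :
    (ZMod 2 × (Fin n → ZMod 2)) →ₗ[ZMod 2] (Fin (n + 2) → ZMod 2) :=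
  (LinearMap.toSpanSingleton (ZMod 2) (Fin (n + 2) → ZMod 2)
    (Fin.cons 1 (Fin.cons 1 x))).coprod (padZeros n)

lemma extendByRow_apply {n : ℕ} (x : Fin n → ZMod 2) (a : ZMod 2) (v : Fin n → ZMod 2) :
    extendByRow x (a, v) = Fin.cons a (Fin.cons a (a • x + v)) := by
  ext i
  refine Fin.cases ?_ (fun i => Fin.cases ?_ (fun i => ?_) i) i <;>
    simp [extendByRow, padZeros_apply]

lemma extendByRow_injective {n : ℕ} (x : Fin n → ZMod 2) :
    Function.Injective (extendByRow x) := by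
  rintro ⟨a, v⟩ ⟨b, w⟩ h
  rw [extendByRow_apply, extendByRow_apply] at h
  obtain ⟨rfl, h⟩ := Fin.cons_injective2 h
  rw [add_left_cancel (Fin.cons_injective2 h).2]

lemma extendByRow_dotProduct {n : ℕ} {x v w : Fin n → ZMod 2} (hx : x ⬝ᵥ x = 0)
    (hv : x ⬝ᵥ v = 0) (hw : x ⬝ᵥ w = 0) (a b : ZMod 2) :
    extendByRow x (a, v) ⬝ᵥ extendByRow x (b, w) = v ⬝ᵥ w := by
  have h : extendByRow x (a, v) ⬝ᵥ extendByRow x (b, w) =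
      a * b + (a * b + (a • x + v) ⬝ᵥ (b • x + w)) := by
    simp only [extendByRow_apply]
    simp [dotProduct, Fin.sum_univ_succ]
  rw [h, ← add_assoc, CharTwo.add_self_eq_zero]
  simp [hx, hw, dotProduct_comm v x, hv]

lemma finrank_map_extendByRow {n : ℕ} (x : Fin n → ZMod 2)
    (C : Submodule (ZMod 2) (Fin n → ZMod 2)) :
    Module.finrank (ZMod 2) ↥((Submodule.prod ⊤ C).map (extendByRow x)) =
      Module.finrank (ZMod 2) ↥C + 1 := by
  have hinj : Function.Injective
      ((extendByRow x).comp ((LinearMap.id (M := ZMod 2)).prodMap C.subtype)) :=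
    (extendByRow_injective x).comp (Function.injective_id.prodMap C.injective_subtype)
  have hrange := LinearMap.finrank_range_of_inj hinj
  rw [LinearMap.range_comp, LinearMap.range_prodMap, LinearMap.range_id, Submodule.range_subtype,
    Module.finrank_prod, Module.finrank_self] at hrange
  rw [hrange, add_comm]

lemma hull_map_extendByRow {n : ℕ} {x : Fin n → ZMod 2} (hx : x ⬝ᵥ x = 0)
    {C : Submodule (ZMod 2) (Fin n → ZMod 2)} (hC : ∀ c ∈ C, x ⬝ᵥ c = 0) :
    hull ((Submodule.prod ⊤ C).map (extendByRow x)) =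
      (Submodule.prod ⊤ (hull C)).map (extendByRow x) := by
  ext z
  constructor
  · rintro ⟨⟨⟨a, v⟩, ⟨-, hv⟩, rfl⟩, hz⟩
    refine ⟨(a, v), ⟨trivial, hv, fun c hc => ?_⟩, rfl⟩
    rw [← extendByRow_dotProduct hx (hC v hv) (hC c hc) a 0]
    exact hz _ ⟨(0, c), ⟨trivial, hc⟩, rfl⟩
  · rintro ⟨⟨a, v⟩, ⟨-, hv, hv'⟩, rfl⟩
    refine ⟨⟨(a, v), ⟨trivial, hv⟩, rfl⟩, ?_⟩
    rintro _ ⟨⟨b, c⟩, ⟨-, hc⟩, rfl⟩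
    rw [extendByRow_dotProduct hx (hC v hv) (hC c hc)]
    exact hv' c hc

lemma span_cons_padZeros {n k : ℕ} (x : Fin n → ZMod 2) (r : Fin k → Fin n → ZMod 2) :
    Submodule.span (ZMod 2) (Set.range (Fin.cons (Fin.cons 1 (Fin.cons 1 x))
      (fun i => padZeros n (r i)) : Fin (k + 1) → Fin (n + 2) → ZMod 2)) =
      (Submodule.prod ⊤ (Submodule.span (ZMod 2) (Set.range r))).map (extendByRow x) := by
  have h : Set.range (fun i => padZeros n (r i)) = padZeros n '' Set.range r :=
    Set.range_comp _ _
  rw [Fin.range_cons, Submodule.span_insert, h, Submodule.span_image, extendByRow,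
    LinearMap.map_coprod_prod, Submodule.map_top, LinearMap.range_toSpanSingleton]

/-- Construction II: from a binary `[n,k]` code with hull dimension `ℓ`
and `x` with `x ⬝ᵥ x = 0` and `yᵢ = x ⬝ᵥ rᵢ = 0` for all `i`, the matrix `G₂` with
first row `(1,1,x)` and rows `(yᵢ, 0, rᵢ)` has linearly independent rows, generating
an `[n+2, k+1]` code `C₂` with `h(C₂) = ℓ + 1`. -/
theorem constructionII_hull {n k ℓ : ℕ}
    (G : Matrix (Fin k) (Fin n) (ZMod 2))
    (hG : LinearIndependent (ZMod 2) (fun i => G i))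
    (C : Submodule (ZMod 2) (Fin n → ZMod 2))
    (hC : C = Submodule.span (ZMod 2) (Set.range fun i => G i))
    (hℓ : Module.finrank (ZMod 2) ↥(hull C) = ℓ)
    (x : Fin n → ZMod 2) (hx : x ⬝ᵥ x = 0)
    (hy : ∀ i, x ⬝ᵥ G i = 0)
    (G₂ : Matrix (Fin (k + 1)) (Fin (n + 2)) (ZMod 2))
    (hG₂ : G₂ = Matrix.of (Fin.cons (Fin.cons 1 (Fin.cons 1 x))
      (fun i => Fin.cons (x ⬝ᵥ G i) (Fin.cons 0 (G i)))))
    (C₂ : Submodule (ZMod 2) (Fin (n + 2) → ZMod 2))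
    (hC₂ : C₂ = Submodule.span (ZMod 2) (Set.range fun i => G₂ i)) :
    LinearIndependent (ZMod 2) (fun i => G₂ i) ∧
      Module.finrank (ZMod 2) ↥C₂ = k + 1 ∧
      Module.finrank (ZMod 2) ↥(hull C₂) = ℓ + 1 := by
  have hrows : (fun i => G₂ i) = Fin.cons (Fin.cons 1 (Fin.cons 1 x))
      (fun i => padZeros n (G i)) := by
    subst hG₂
    simp only [hy]
    rfl
  have hxC : ∀ c ∈ C, x ⬝ᵥ c = 0 := by
    subst hC
    intro c hc
    induction hc using Submodule.span_induction with
    | mem c hc => obtain ⟨i, rfl⟩ := hc; exact hy i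
    | zero => exact dotProduct_zero x
    | add u v _ _ hu hv => rw [dotProduct_add, hu, hv, add_zero]
    | smul a v _ hv => rw [dotProduct_smul, hv, smul_zero]
  have hC₂' : C₂ = (Submodule.prod ⊤ C).map (extendByRow x) := by
    rw [hC₂, hrows, hC]
    exact span_cons_padZeros x fun i => G i
  have hdim : Module.finrank (ZMod 2) ↥C₂ = k + 1 := by
    rw [hC₂', finrank_map_extendByRow, hC, finrank_span_eq_card hG, Fintype.card_fin]
  refine ⟨?_, hdim, ?_⟩
  · rw [linearIndependent_iff_card_eq_finrank_span, Set.finrank, ← hC₂, hdim, Fintype.card_fin]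
  · rw [hC₂', hull_map_extendByRow hx hxC, finrank_map_extendByRow, hℓ]
end

section
/- Let C be a binary linear [n,k] code with generator matrix G (rows r₁,…,r_k linearly independent) and h(C) = ℓ. Let x ∈ GF(2)^n satisfy x·x = 0 and set y_i = x·r_i. Then the (k+1)×(n+2) matrix G₂ whose first row is (1, 1, x₁, …, x_n) and whose (i+1)-st row is (y_i, 0, r_i) has linearly independent rows, so the code C₂ it generates is a binary [n+2, k+1] code, and h(C₂) ∈ {ℓ, ℓ + 1, ℓ + 2}. -/
open Matrix

/-- The coordinate extension `c ↦ (x ⬝ᵥ c, 0, c)`. -/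
def extendWord {n : ℕ} (x : Fin n → ZMod 2) :
    (Fin n → ZMod 2) →ₗ[ZMod 2] (Fin (n + 2) → ZMod 2) where
  toFun c := Fin.cons (x ⬝ᵥ c) (Fin.cons 0 c)
  map_add' a b := by
    ext i
    refine Fin.cases ?_ (fun i => Fin.cases ?_ (fun i => ?_) i) i <;> simp [dotProduct_add]
  map_smul' a b := by
    ext i
    refine Fin.cases ?_ (fun i => Fin.cases ?_ (fun i => ?_) i) i <;> simp [dotProduct_smul]

/-- The word `(1, 1, x)`. -/
def leadingWord {n : ℕ} (x : Fin n → ZMod 2) : Fin (n + 2) → ZMod 2 :=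
  Fin.cons 1 (Fin.cons 1 x)

/-- The linear map `(a, c) ↦ a (1, 1, x) + (x ⬝ᵥ c, 0, c)`. -/
def constructionMap {n : ℕ} (x : Fin n → ZMod 2) :
    (ZMod 2 × (Fin n → ZMod 2)) →ₗ[ZMod 2] (Fin (n + 2) → ZMod 2) :=
  (LinearMap.toSpanSingleton (ZMod 2) _ (leadingWord x)).coprod (extendWord x)

section

variable {n : ℕ} (x : Fin n → ZMod 2)

theorem constructionMap_eq (a : ZMod 2) (c : Fin n → ZMod 2) :
    constructionMap x (a, c) = Fin.cons (a + x ⬝ᵥ c) (Fin.cons a (a • x + c)) := by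
  ext i
  refine Fin.cases ?_ (fun i => Fin.cases ?_ (fun i => ?_) i) i <;>
    simp [constructionMap, extendWord, leadingWord]

theorem constructionMap_injective : Function.Injective (constructionMap x) := by
  rintro ⟨a, c⟩ ⟨b, d⟩ h
  rw [constructionMap_eq, constructionMap_eq] at h
  obtain ⟨-, h⟩ := Fin.cons_injective2 h
  obtain ⟨rfl, h⟩ := Fin.cons_injective2 h
  rw [add_left_cancel h]

theorem fin_cons_dotProduct_cons {m : ℕ} (a b : ZMod 2) (u v : Fin m → ZMod 2) :
    (Fin.cons a u : Fin (m + 1) → ZMod 2) ⬝ᵥ (Fin.cons b v : Fin (m + 1) → ZMod 2) =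
      a * b + u ⬝ᵥ v := by
  simp [dotProduct, Fin.sum_univ_succ]

variable {x} in
theorem constructionMap_dotProduct (hx : x ⬝ᵥ x = 0) (a b : ZMod 2) (c d : Fin n → ZMod 2) :
    constructionMap x (a, c) ⬝ᵥ constructionMap x (b, d) =
      (x ⬝ᵥ c) * (x ⬝ᵥ d) + c ⬝ᵥ d := by
  rw [constructionMap_eq, constructionMap_eq, fin_cons_dotProduct_cons, fin_cons_dotProduct_cons]
  simp only [add_dotProduct, dotProduct_add, smul_dotProduct, dotProduct_smul, hx, smul_eq_mul,
    dotProduct_comm c x]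
  linear_combination (a * b + a * (x ⬝ᵥ d) + b * (x ⬝ᵥ c)) * (CharTwo.two_eq_zero (R := ZMod 2))

theorem finrank_le_finrank_inf_ker_add_one {K V : Type*} [Field K] [AddCommGroup V] [Module K V]
    [FiniteDimensional K V] (p : Submodule K V) (φ : V →ₗ[K] K) :
    Module.finrank K p ≤ Module.finrank K ↥(p ⊓ LinearMap.ker φ) + 1 := by
  have h₁ := Submodule.finrank_sup_add_finrank_inf_eq p (LinearMap.ker φ)
  have h₂ := φ.finrank_range_add_finrank_ker
  have h₃ := (p ⊔ LinearMap.ker φ).finrank_le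
  have h₄ := (LinearMap.range φ).finrank_le
  rw [Module.finrank_self] at h₄
  omega

theorem hull_map_constructionMap_inf_ker (hx : x ⬝ᵥ x = 0)
    (C : Submodule (ZMod 2) (Fin n → ZMod 2)) :
    hull ((Submodule.prod ⊤ C).map (constructionMap x)) ⊓
        LinearMap.ker (LinearMap.proj (R := ZMod 2) (φ := fun _ : Fin (n + 2) => ZMod 2) 0 -
          LinearMap.proj 1) =
      (Submodule.prod ⊤ (hull C ⊓ LinearMap.ker (dotProductBilin (ZMod 2) (ZMod 2) x))).map
        (constructionMap x) := by
  ext w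
  constructor
  · rintro ⟨⟨⟨⟨a, c⟩, ⟨-, hc⟩, rfl⟩, hdual⟩, hker⟩
    have hφ : x ⬝ᵥ c = 0 := by
      simpa [constructionMap_eq, Fin.cons_one] using hker
    refine ⟨(a, c), ⟨trivial, ⟨hc, fun d hd => ?_⟩, hφ⟩, rfl⟩
    have := hdual _ (Submodule.mem_map_of_mem (f := constructionMap x)
      (show ((0 : ZMod 2), d) ∈ Submodule.prod ⊤ C from ⟨trivial, hd⟩))
    rwa [constructionMap_dotProduct hx, hφ, zero_mul, zero_add] at this
  · rintro ⟨⟨a, c⟩, ⟨-, ⟨hc, hdual⟩, hφ⟩, rfl⟩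
    replace hφ : x ⬝ᵥ c = 0 := hφ
    refine ⟨⟨⟨(a, c), ⟨trivial, hc⟩, rfl⟩, ?_⟩, ?_⟩
    · rintro _ ⟨⟨b, d⟩, ⟨-, hd⟩, rfl⟩
      rw [constructionMap_dotProduct hx, hφ, zero_mul, zero_add]
      exact hdual d hd
    · simpa [constructionMap_eq, Fin.cons_one] using hφ

theorem finrank_map_constructionMap (C : Submodule (ZMod 2) (Fin n → ZMod 2)) :
    Module.finrank (ZMod 2) ((Submodule.prod ⊤ C).map (constructionMap x)) =
      Module.finrank (ZMod 2) C + 1 := by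
  have hinj : Function.Injective (constructionMap x ∘ₗ LinearMap.id.prodMap C.subtype) :=
    (constructionMap_injective x).comp (Function.injective_id.prodMap C.subtype_injective)
  have hrange : (Submodule.prod ⊤ C).map (constructionMap x) =
      LinearMap.range (constructionMap x ∘ₗ LinearMap.id.prodMap C.subtype) := by
    rw [LinearMap.range_comp, LinearMap.range_prodMap, LinearMap.range_id, C.range_subtype]
  rw [hrange, LinearMap.finrank_range_of_inj hinj, Module.finrank_prod, Module.finrank_self,
    add_comm]

theorem finrank_hull_map_constructionMap (hx : x ⬝ᵥ x = 0)
    (C : Submodule (ZMod 2) (Fin n → ZMod 2)) :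
    Module.finrank (ZMod 2) (hull C) ≤
        Module.finrank (ZMod 2) (hull ((Submodule.prod ⊤ C).map (constructionMap x))) ∧
      Module.finrank (ZMod 2) (hull ((Submodule.prod ⊤ C).map (constructionMap x))) ≤
        Module.finrank (ZMod 2) (hull C) + 2 := by
  have h₁ := finrank_le_finrank_inf_ker_add_one (hull C) (dotProductBilin (ZMod 2) (ZMod 2) x)
  have h₂ := finrank_le_finrank_inf_ker_add_one
    (hull ((Submodule.prod ⊤ C).map (constructionMap x)))
    (LinearMap.proj (R := ZMod 2) (φ := fun _ : Fin (n + 2) => ZMod 2) 0 - LinearMap.proj 1)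
  have h₃ := Submodule.finrank_mono (inf_le_left :
    hull C ⊓ LinearMap.ker (dotProductBilin (ZMod 2) (ZMod 2) x) ≤ _)
  have h₄ := Submodule.finrank_mono (inf_le_left :
    hull ((Submodule.prod ⊤ C).map (constructionMap x)) ⊓
      LinearMap.ker (LinearMap.proj (R := ZMod 2) (φ := fun _ : Fin (n + 2) => ZMod 2) 0 -
        LinearMap.proj 1) ≤ _)
  rw [hull_map_constructionMap_inf_ker x hx, finrank_map_constructionMap] at h₂ h₄
  omega

end

/-- Construction II/III: from a binary `[n,k]` code with hull dimension
`ℓ` and `x` with `x ⬝ᵥ x = 0`, the matrix `G₂` with first row `(1,1,x)` and rows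
`(yᵢ, 0, rᵢ)` has linearly independent rows, generating an `[n+2, k+1]` code `C₂`
with `h(C₂) ∈ {ℓ, ℓ + 1, ℓ + 2}`. -/
theorem constructionIII_hull {n k ℓ : ℕ}
    (G : Matrix (Fin k) (Fin n) (ZMod 2))
    (hG : LinearIndependent (ZMod 2) (fun i => G i))
    (C : Submodule (ZMod 2) (Fin n → ZMod 2))
    (hC : C = Submodule.span (ZMod 2) (Set.range fun i => G i))
    (hℓ : Module.finrank (ZMod 2) ↥(hull C) = ℓ)
    (x : Fin n → ZMod 2) (hx : x ⬝ᵥ x = 0)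
    (G₂ : Matrix (Fin (k + 1)) (Fin (n + 2)) (ZMod 2))
    (hG₂ : G₂ = Matrix.of (Fin.cons (Fin.cons 1 (Fin.cons 1 x))
      (fun i => Fin.cons (x ⬝ᵥ G i) (Fin.cons 0 (G i)))))
    (C₂ : Submodule (ZMod 2) (Fin (n + 2) → ZMod 2))
    (hC₂ : C₂ = Submodule.span (ZMod 2) (Set.range fun i => G₂ i)) :
    LinearIndependent (ZMod 2) (fun i => G₂ i) ∧
      Module.finrank (ZMod 2) ↥C₂ = k + 1 ∧
      (Module.finrank (ZMod 2) ↥(hull C₂) = ℓ ∨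
        Module.finrank (ZMod 2) ↥(hull C₂) = ℓ + 1 ∨
        Module.finrank (ZMod 2) ↥(hull C₂) = ℓ + 2) := by
  have hrows : (fun i => G₂ i) =
      Fin.cons (leadingWord x) (fun i => extendWord x (G i)) := by
    subst hG₂
    funext i
    refine Fin.cases rfl (fun i => rfl) i
  have hC₂' : C₂ = (Submodule.prod ⊤ C).map (constructionMap x) := by
    rw [hC₂, hrows, Fin.range_cons, Submodule.span_insert, constructionMap,
      LinearMap.map_coprod_prod, hC, Submodule.map_span, ← Set.range_comp,
      ← LinearMap.range_eq_map, LinearMap.range_toSpanSingleton]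
    rfl
  have hfin : Module.finrank (ZMod 2) C₂ = k + 1 := by
    rw [hC₂', finrank_map_constructionMap, hC, finrank_span_eq_card hG, Fintype.card_fin]
  refine ⟨?_, hfin, ?_⟩
  · rw [linearIndependent_iff_card_eq_finrank_span, Set.finrank, ← hC₂, hfin, Fintype.card_fin]
  · have := finrank_hull_map_constructionMap x hx C
    rw [← hC₂', hℓ] at this
    omega
end

section
/- Let C be a binary linear [n,k] code with generator matrix G (rows r₁,…,r_k) and parity check matrix H (rows s₁,…,s_{n−k}, a generator matrix of C⊥). Let x ∈ GF(2)^n satisfy x·x = 0, set y_i = x·r_i and z_j = x·s_j. Let G₂ be the (k+1)×(n+2) matrix with first row (1, 1, x₁, …, x_n) and (i+1)-st row (y_i, 0, r_i), generating the code C₂, and let H₂ be the (n−k+1)×(n+2) matrix with first row (1, 1, x₁, …, x_n) and (j+1)-st row (0, z_j, s_j). Then H₂ is a parity check matrix for C₂, i.e., the row space of H₂ equals C₂⊥. -/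
open Matrix

theorem cons_cons_dotProduct_cons_cons {n : ℕ} (a b c d : ZMod 2) (v w : Fin n → ZMod 2) :
    (Fin.cons a (Fin.cons b v) : Fin (n + 2) → ZMod 2) ⬝ᵥ
      (Fin.cons c (Fin.cons d w) : Fin (n + 2) → ZMod 2) = a * c + (b * d + v ⬝ᵥ w) := by
  simp [dotProduct, Fin.sum_univ_succ]

/-- The linear map `u ↦ (0, x ⬝ᵥ u, u)`. -/
def parityExtension {n : ℕ} (x : Fin n → ZMod 2) :
    (Fin n → ZMod 2) →ₗ[ZMod 2] (Fin (n + 2) → ZMod 2) where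
  toFun u := Fin.cons 0 (Fin.cons (x ⬝ᵥ u) u)
  map_add' u v := by
    ext i
    refine Fin.cases ?_ (Fin.cases ?_ fun j => ?_) i <;> simp [dotProduct_add]
  map_smul' a u := by
    ext i
    refine Fin.cases ?_ (Fin.cases ?_ fun j => ?_) i <;> simp [dotProduct_smul]

/-- For Construction II/III applied to a binary `[n,k]` code `C` with
generator matrix `G`, parity check matrix `H`, and `x` with `x ⬝ᵥ x = 0`, the matrix
`H₂` with first row `(1,1,x)` and rows `(0, z_j, s_j)` is a parity check matrix for
the code `C₂` generated by `G₂`, i.e. the row space of `H₂` equals `C₂⊥`. -/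
theorem constructionII_III_parityCheck {n k : ℕ}
    (G : Matrix (Fin k) (Fin n) (ZMod 2))
    (hG : LinearIndependent (ZMod 2) (fun i => G i))
    (H : Matrix (Fin (n - k)) (Fin n) (ZMod 2))
    (hH : LinearIndependent (ZMod 2) (fun j => H j))
    (C : Submodule (ZMod 2) (Fin n → ZMod 2))
    (hC : C = Submodule.span (ZMod 2) (Set.range fun i => G i))
    (hHdual : Submodule.span (ZMod 2) (Set.range fun j => H j) = dualCode C)
    (x : Fin n → ZMod 2) (hx : x ⬝ᵥ x = 0)
    (G₂ : Matrix (Fin (k + 1)) (Fin (n + 2)) (ZMod 2))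
    (hG₂ : G₂ = Matrix.of (Fin.cons (Fin.cons 1 (Fin.cons 1 x))
      (fun i => Fin.cons (x ⬝ᵥ G i) (Fin.cons 0 (G i)))))
    (C₂ : Submodule (ZMod 2) (Fin (n + 2) → ZMod 2))
    (hC₂ : C₂ = Submodule.span (ZMod 2) (Set.range fun i => G₂ i))
    (H₂ : Matrix (Fin (n - k + 1)) (Fin (n + 2)) (ZMod 2))
    (hH₂ : H₂ = Matrix.of (Fin.cons (Fin.cons 1 (Fin.cons 1 x))
      (fun j => Fin.cons 0 (Fin.cons (x ⬝ᵥ H j) (H j))))) :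
    Submodule.span (ZMod 2) (Set.range fun j => H₂ j) = dualCode C₂ := by
  subst hC hG₂ hC₂ hH₂
  have hxx : ∀ a : ZMod 2, a + a = 0 := CharTwo.add_self_eq_zero
  apply le_antisymm
  · rw [Submodule.span_le]
    rintro _ ⟨j, rfl⟩
    rw [SetLike.mem_coe, mem_dualCode_span_range]
    intro i
    refine Fin.cases ?_ (fun j => ?_) j <;> refine Fin.cases ?_ (fun i => ?_) i
    · refine (cons_cons_dotProduct_cons_cons 1 1 1 1 x x).trans ?_
      simp [hx, hxx]
    · refine (cons_cons_dotProduct_cons_cons 1 1 (x ⬝ᵥ G i) 0 x (G i)).trans ?_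
      simp [hxx]
    · refine (cons_cons_dotProduct_cons_cons 0 (x ⬝ᵥ H j) 1 1 (H j) x).trans ?_
      simp [dotProduct_comm (H j) x, hxx]
    · have hj : H j ∈ dualCode (Submodule.span (ZMod 2) (Set.range fun i => G i)) :=
        hHdual ▸ Submodule.subset_span ⟨j, rfl⟩
      refine (cons_cons_dotProduct_cons_cons 0 (x ⬝ᵥ H j) (x ⬝ᵥ G i) 0 (H j) (G i)).trans ?_
      simp [(mem_dualCode_span_range _ _).1 hj i]
  · intro v hv
    rw [mem_dualCode_span_range] at hv
    obtain ⟨a, b, w, rfl⟩ : ∃ a b w, v = Fin.cons a (Fin.cons b w) :=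
      ⟨v 0, Fin.tail v 0, Fin.tail (Fin.tail v), by simp only [Fin.cons_self_tail]⟩
    have hv₀ : a + (b + w ⬝ᵥ x) = 0 := by
      simpa using (cons_cons_dotProduct_cons_cons a b 1 1 w x).symm.trans (hv 0)
    have hu : w + a • x ∈ dualCode (Submodule.span (ZMod 2) (Set.range fun i => G i)) := by
      rw [mem_dualCode_span_range]
      intro i
      have hvi := (cons_cons_dotProduct_cons_cons a b (x ⬝ᵥ G i) 0 w (G i)).symm.trans (hv i.succ)
      simp only [add_dotProduct, smul_dotProduct, smul_eq_mul]
      linear_combination hvi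
    rw [← hHdual] at hu
    have hle : (Submodule.span (ZMod 2) (Set.range fun j => H j)).map (parityExtension x) ≤
        Submodule.span (ZMod 2) (Set.range fun j => (Matrix.of
          (Fin.cons (Fin.cons 1 (Fin.cons 1 x))
            (fun j => Fin.cons 0 (Fin.cons (x ⬝ᵥ H j) (H j)))) :
              Matrix (Fin (n - k + 1)) (Fin (n + 2)) (ZMod 2)) j) := by
      rw [Submodule.map_span_le]
      rintro _ ⟨j, rfl⟩
      exact Submodule.subset_span ⟨j.succ, rfl⟩
    have hdecomp : (Fin.cons a (Fin.cons b w) : Fin (n + 2) → ZMod 2) =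
        a • (Fin.cons 1 (Fin.cons 1 x) : Fin (n + 2) → ZMod 2) +
          parityExtension x (w + a • x) := by
      ext i
      refine Fin.cases ?_ (Fin.cases ?_ fun j => ?_) i
      · simp [parityExtension]
      · simp only [parityExtension, LinearMap.coe_mk, AddHom.coe_mk, Pi.add_apply, Pi.smul_apply,
          Fin.cons_succ, Fin.cons_zero, dotProduct_add, dotProduct_smul, hx, smul_eq_mul,
          dotProduct_comm x w]
        linear_combination hv₀ - hxx a - hxx (w ⬝ᵥ x)
      · simp only [parityExtension, LinearMap.coe_mk, AddHom.coe_mk, Pi.add_apply, Pi.smul_apply,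
          Fin.cons_succ, smul_eq_mul]
        linear_combination -hxx (a * x j)
    rw [hdecomp]
    exact add_mem (Submodule.smul_mem _ _ (Submodule.subset_span ⟨0, rfl⟩))
      (hle (Submodule.mem_map_of_mem hu))
end

section
/- Let C be a binary linear [n,k] code with generator matrix G (rows r₁,…,r_k linearly independent) and h(C) = ℓ. Let x ∈ GF(2)^n satisfy x·x = 0 and set y_i = x·r_i. Then the (k+1)×(n+2) matrix G₃ whose first row is (1, 0, x₁, …, x_n) and whose (i+1)-st row is (y_i, y_i, r_i) has linearly independent rows, so the code C₃ it generates is a binary [n+2, k+1] code, and h(C₃) = ℓ. -/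
open Matrix

/-- The isometric embedding `c ↦ (x ⬝ᵥ c, x ⬝ᵥ c, c)` of `GF(2)^n` into `GF(2)^(n+2)`. -/
def doubleExtend {n : ℕ} (x : Fin n → ZMod 2) :
    (Fin n → ZMod 2) →ₗ[ZMod 2] (Fin (n + 2) → ZMod 2) where
  toFun c := Fin.cons (x ⬝ᵥ c) (Fin.cons (x ⬝ᵥ c) c)
  map_add' a b := by
    ext i
    refine Fin.cases ?_ (fun i => Fin.cases ?_ (fun i => ?_) i) i <;> simp [dotProduct_add]
  map_smul' a b := by
    ext i
    refine Fin.cases ?_ (fun i => Fin.cases ?_ (fun i => ?_) i) i <;> simp [dotProduct_smul]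

theorem doubleExtend_apply {n : ℕ} (x c : Fin n → ZMod 2) :
    doubleExtend x c = Fin.cons (x ⬝ᵥ c) (Fin.cons (x ⬝ᵥ c) c) := rfl

theorem doubleExtend_injective {n : ℕ} (x : Fin n → ZMod 2) :
    Function.Injective (doubleExtend x) := by
  intro a b h
  ext i
  simpa [doubleExtend_apply] using congrFun h i.succ.succ

theorem cons_cons_dotProduct {n : ℕ} (a b c d : ZMod 2) (u v : Fin n → ZMod 2) :
    (Fin.cons a (Fin.cons b u) : Fin (n + 2) → ZMod 2) ⬝ᵥ Fin.cons c (Fin.cons d v) =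
      a * c + (b * d + u ⬝ᵥ v) := by
  simp [dotProduct, Fin.sum_univ_succ]

theorem doubleExtend_dotProduct {n : ℕ} (x c d : Fin n → ZMod 2) :
    doubleExtend x c ⬝ᵥ doubleExtend x d = c ⬝ᵥ d := by
  rw [doubleExtend_apply, doubleExtend_apply, cons_cons_dotProduct, ← add_assoc,
    CharTwo.add_self_eq_zero, zero_add]

theorem cons_one_cons_zero_dotProduct_doubleExtend {n : ℕ} (x c : Fin n → ZMod 2) :
    (Fin.cons 1 (Fin.cons 0 x) : Fin (n + 2) → ZMod 2) ⬝ᵥ doubleExtend x c = 0 := by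
  rw [doubleExtend_apply, cons_cons_dotProduct, one_mul, zero_mul, zero_add,
    CharTwo.add_self_eq_zero]

/-- Adjoining an anisotropic vector orthogonal to an isometric copy of a code does not change
its hull. -/
theorem hull_span_singleton_sup_map {n m : ℕ} (C : Submodule (ZMod 2) (Fin n → ZMod 2))
    (f : (Fin n → ZMod 2) →ₗ[ZMod 2] (Fin m → ZMod 2)) (v : Fin m → ZMod 2)
    (hf : ∀ c d, f c ⬝ᵥ f d = c ⬝ᵥ d) (hv : v ⬝ᵥ v = 1) (hvf : ∀ c, v ⬝ᵥ f c = 0) :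
    hull (Submodule.span (ZMod 2) {v} ⊔ C.map f) = (hull C).map f := by
  ext w
  constructor
  · rintro ⟨hw, hw'⟩
    obtain ⟨_, hu, _, ⟨c, hc, rfl⟩, rfl⟩ := Submodule.mem_sup.1 hw
    obtain ⟨a, rfl⟩ := Submodule.mem_span_singleton.1 hu
    have ha := hw' v (Submodule.mem_sup_left (Submodule.mem_span_singleton_self v))
    rw [add_dotProduct, smul_dotProduct, hv, dotProduct_comm, hvf, add_zero, smul_eq_mul,
      mul_one] at ha
    subst ha
    refine ⟨c, ⟨hc, fun d hd => ?_⟩, by simp⟩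
    have hcd := hw' (f d) (Submodule.mem_sup_right ⟨d, hd, rfl⟩)
    rwa [zero_smul, zero_add, hf] at hcd
  · rintro ⟨c, ⟨hc, hc'⟩, rfl⟩
    refine ⟨Submodule.mem_sup_right ⟨c, hc, rfl⟩, fun w hw => ?_⟩
    obtain ⟨_, hu, _, ⟨d, hd, rfl⟩, rfl⟩ := Submodule.mem_sup.1 hw
    obtain ⟨a, rfl⟩ := Submodule.mem_span_singleton.1 hu
    rw [dotProduct_add, dotProduct_smul, dotProduct_comm, hvf, smul_zero, zero_add, hf]
    exact hc' d hd

/-- Construction IV: from a binary `[n,k]` code with hull dimension `ℓ`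
and `x` with `x ⬝ᵥ x = 0`, the matrix `G₃` with first row `(1,0,x)` and rows
`(yᵢ, yᵢ, rᵢ)` has linearly independent rows, generating an `[n+2, k+1]` code `C₃`
with `h(C₃) = ℓ`. -/
theorem constructionIV_hull {n k ℓ : ℕ}
    (G : Matrix (Fin k) (Fin n) (ZMod 2))
    (hG : LinearIndependent (ZMod 2) (fun i => G i))
    (C : Submodule (ZMod 2) (Fin n → ZMod 2))
    (hC : C = Submodule.span (ZMod 2) (Set.range fun i => G i))
    (hℓ : Module.finrank (ZMod 2) ↥(hull C) = ℓ)
    (x : Fin n → ZMod 2) (hx : x ⬝ᵥ x = 0)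
    (G₃ : Matrix (Fin (k + 1)) (Fin (n + 2)) (ZMod 2))
    (hG₃ : G₃ = Matrix.of (Fin.cons (Fin.cons 1 (Fin.cons 0 x))
      (fun i => Fin.cons (x ⬝ᵥ G i) (Fin.cons (x ⬝ᵥ G i) (G i)))))
    (C₃ : Submodule (ZMod 2) (Fin (n + 2) → ZMod 2))
    (hC₃ : C₃ = Submodule.span (ZMod 2) (Set.range fun i => G₃ i)) :
    LinearIndependent (ZMod 2) (fun i => G₃ i) ∧
      Module.finrank (ZMod 2) ↥C₃ = k + 1 ∧
      Module.finrank (ZMod 2) ↥(hull C₃) = ℓ := by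
  set v : Fin (n + 2) → ZMod 2 := Fin.cons 1 (Fin.cons 0 x) with hv_def
  have hvv : v ⬝ᵥ v = 1 := by
    rw [hv_def, cons_cons_dotProduct, hx]
    simp
  have hvf : ∀ c, v ⬝ᵥ doubleExtend x c = 0 := cons_one_cons_zero_dotProduct_doubleExtend x
  have hrows : (fun i => G₃ i) = Fin.cons v (doubleExtend x ∘ fun i => G i) := by
    subst hG₃
    rfl
  have hspan : Submodule.span (ZMod 2) (Set.range (doubleExtend x ∘ fun i => G i)) =
      C.map (doubleExtend x) := by
    rw [hC, Submodule.map_span, Set.range_comp]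
  have hind : LinearIndependent (ZMod 2) (fun i => G₃ i) := by
    rw [hrows, linearIndependent_finCons]
    refine ⟨hG.map' _ (LinearMap.ker_eq_bot.2 (doubleExtend_injective x)), ?_⟩
    rw [hspan]
    rintro ⟨c, -, hc⟩
    have h := hvf c
    rw [hc, hvv] at h
    exact one_ne_zero h
  have hC₃' : C₃ = Submodule.span (ZMod 2) {v} ⊔ C.map (doubleExtend x) := by
    rw [hC₃, hrows, Fin.range_cons, Submodule.span_insert, hspan]
  refine ⟨hind, ?_, ?_⟩
  · rw [hC₃, finrank_span_eq_card hind, Fintype.card_fin]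
  · rw [hC₃', hull_span_singleton_sup_map C _ v (doubleExtend_dotProduct x) hvv hvf,
      ← hℓ]
    exact (Submodule.equivMapOfInjective _ (doubleExtend_injective x) _).finrank_eq.symm
end

section
/- Let C be a nonzero binary linear [n,k] code with generator matrix G (rows r₁,…,r_k), let x ∈ GF(2)^n satisfy x·x = 0 and x·r_i = 0 for all 1 ≤ i ≤ k, and let C₂ be the code generated by the (k+1)×(n+2) matrix G₂ with first row (1, 1, x₁, …, x_n) and (i+1)-st rows (0, 0, r_i). Then the minimum distance d(C₂) equals min{d(C), weight(x + C) + 2}, where weight(x + C) = min_{c∈C} wt(x + c). -/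
open Matrix

/-- The minimum distance of a binary linear code: the smallest Hamming weight of a
nonzero codeword. -/
noncomputable def minDist {n : ℕ} (C : Submodule (ZMod 2) (Fin n → ZMod 2)) : ℕ :=
  sInf {w | ∃ c ∈ C, c ≠ 0 ∧ hammingNorm c = w}

/-- The minimum weight of the coset `x + C`: `weight(x + C) = min_{c ∈ C} wt(x + c)`. -/
noncomputable def cosetWeight {n : ℕ} (x : Fin n → ZMod 2)
    (C : Submodule (ZMod 2) (Fin n → ZMod 2)) : ℕ :=
  sInf {w | ∃ c ∈ C, hammingNorm (x + c) = w}

/-- Prepending a coordinate `a` adds one to the Hamming weight unless `a = 0`. -/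
theorem hammingNorm_fin_cons {n : ℕ} {R : Type*} [DecidableEq R] [Zero R] (a : R) (v : Fin n → R) :
    hammingNorm (Fin.cons a v : Fin (n + 1) → R) = (if a = 0 then 0 else 1) + hammingNorm v := by
  simp only [hammingNorm, Finset.card_filter, Fin.sum_univ_succ, Fin.cons_zero, Fin.cons_succ,
    ne_eq, ite_not]

/-- Prepending two zero coordinates, as a linear map. -/
def consZeroZero (R : Type*) [Semiring R] (n : ℕ) : (Fin n → R) →ₗ[R] (Fin (n + 2) → R) where
  toFun v := Fin.cons 0 (Fin.cons 0 v)
  map_add' u v := by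
    ext i
    refine Fin.cases ?_ (Fin.cases ?_ fun j => ?_) i <;> simp
  map_smul' a v := by
    ext i
    refine Fin.cases ?_ (Fin.cases ?_ fun j => ?_) i <;> simp

theorem cons_one_cons_one_add_consZeroZero {R : Type*} [Semiring R] {n : ℕ} (x c : Fin n → R) :
    (Fin.cons 1 (Fin.cons 1 x) : Fin (n + 2) → R) + consZeroZero R n c =
      Fin.cons 1 (Fin.cons 1 (x + c)) := by
  ext i
  refine Fin.cases ?_ (Fin.cases ?_ fun j => ?_) i <;> simp [consZeroZero]

/-- The codewords of the code generated by `(1, 1, x)` and the words `(0, 0, rᵢ)`. -/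
theorem mem_span_constructionII {n k : ℕ} (G : Fin k → Fin n → ZMod 2) (x : Fin n → ZMod 2)
    (z : Fin (n + 2) → ZMod 2) :
    z ∈ Submodule.span (ZMod 2) (Set.range
        (Fin.cons (Fin.cons 1 (Fin.cons 1 x)) (fun i => Fin.cons 0 (Fin.cons 0 (G i))) :
          Fin (k + 1) → Fin (n + 2) → ZMod 2)) ↔
      (∃ c ∈ Submodule.span (ZMod 2) (Set.range G), z = Fin.cons 0 (Fin.cons 0 c)) ∨
      ∃ c ∈ Submodule.span (ZMod 2) (Set.range G), z = Fin.cons 1 (Fin.cons 1 (x + c)) := by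
  have hrange : (Set.range fun i => (Fin.cons 0 (Fin.cons 0 (G i)) : Fin (n + 2) → ZMod 2)) =
      consZeroZero (ZMod 2) n '' Set.range G := by
    rw [← Set.range_comp]
    rfl
  have hcases : ∀ a : ZMod 2, a = 0 ∨ a = 1 := by decide
  rw [Fin.range_cons, hrange, Submodule.mem_span_insert, Submodule.span_image]
  constructor
  · rintro ⟨a, _, ⟨c, hc, rfl⟩, rfl⟩
    rcases hcases a with rfl | rfl
    · exact .inl ⟨c, hc, by rw [zero_smul, zero_add]; rfl⟩
    · exact .inr ⟨c, hc, by rw [one_smul, cons_one_cons_one_add_consZeroZero]⟩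
  · rintro (⟨c, hc, rfl⟩ | ⟨c, hc, rfl⟩)
    · exact ⟨0, _, ⟨c, hc, rfl⟩, by rw [zero_smul, zero_add]; rfl⟩
    · exact ⟨1, _, ⟨c, hc, rfl⟩, by rw [one_smul, cons_one_cons_one_add_consZeroZero]⟩

theorem minDist_le {n : ℕ} {C : Submodule (ZMod 2) (Fin n → ZMod 2)} {c : Fin n → ZMod 2}
    (hc : c ∈ C) (h0 : c ≠ 0) : minDist C ≤ hammingNorm c :=
  Nat.sInf_le ⟨c, hc, h0, rfl⟩

theorem exists_hammingNorm_eq_minDist {n : ℕ} {C : Submodule (ZMod 2) (Fin n → ZMod 2)}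
    (hC : C ≠ ⊥) : ∃ c ∈ C, c ≠ 0 ∧ hammingNorm c = minDist C := by
  obtain ⟨c, hc, h0⟩ := C.ne_bot_iff.1 hC
  exact Nat.sInf_mem (s := {w | ∃ c ∈ C, c ≠ 0 ∧ hammingNorm c = w}) ⟨_, c, hc, h0, rfl⟩

theorem cosetWeight_le {n : ℕ} (x : Fin n → ZMod 2) {C : Submodule (ZMod 2) (Fin n → ZMod 2)}
    {c : Fin n → ZMod 2} (hc : c ∈ C) : cosetWeight x C ≤ hammingNorm (x + c) :=
  Nat.sInf_le ⟨c, hc, rfl⟩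

theorem exists_hammingNorm_eq_cosetWeight {n : ℕ} (x : Fin n → ZMod 2)
    (C : Submodule (ZMod 2) (Fin n → ZMod 2)) :
    ∃ c ∈ C, hammingNorm (x + c) = cosetWeight x C :=
  Nat.sInf_mem (s := {w | ∃ c ∈ C, hammingNorm (x + c) = w}) ⟨_, 0, C.zero_mem, rfl⟩

/-- For Construction II (with `x ⬝ᵥ x = 0` and `x ⬝ᵥ rᵢ = 0` for all
`i`) applied to a nonzero binary `[n,k]` code `C`, the minimum distance of `C₂`
equals `min (d(C)) (weight(x + C) + 2)`. -/
theorem constructionII_minDist {n k : ℕ}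
    (G : Matrix (Fin k) (Fin n) (ZMod 2))
    (hG : LinearIndependent (ZMod 2) (fun i => G i))
    (C : Submodule (ZMod 2) (Fin n → ZMod 2)) (hCne : C ≠ ⊥)
    (hC : C = Submodule.span (ZMod 2) (Set.range fun i => G i))
    (x : Fin n → ZMod 2) (hx : x ⬝ᵥ x = 0)
    (hy : ∀ i, x ⬝ᵥ G i = 0)
    (G₂ : Matrix (Fin (k + 1)) (Fin (n + 2)) (ZMod 2))
    (hG₂ : G₂ = Matrix.of (Fin.cons (Fin.cons 1 (Fin.cons 1 x))
      (fun i => Fin.cons 0 (Fin.cons 0 (G i)))))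
    (C₂ : Submodule (ZMod 2) (Fin (n + 2) → ZMod 2))
    (hC₂ : C₂ = Submodule.span (ZMod 2) (Set.range fun i => G₂ i)) :
    minDist C₂ = min (minDist C) (cosetWeight x C + 2) := by
  have hmem (z : Fin (n + 2) → ZMod 2) : z ∈ C₂ ↔
      (∃ c ∈ C, z = Fin.cons 0 (Fin.cons 0 c)) ∨ ∃ c ∈ C, z = Fin.cons 1 (Fin.cons 1 (x + c)) := by
    subst hC hG₂ hC₂
    exact mem_span_constructionII (fun i => G i) x z
  have hzero (c : Fin n → ZMod 2) :
      hammingNorm (Fin.cons 0 (Fin.cons 0 c) : Fin (n + 2) → ZMod 2) = hammingNorm c := by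
    simp [hammingNorm_fin_cons]
  have hone (c : Fin n → ZMod 2) :
      hammingNorm (Fin.cons 1 (Fin.cons 1 c) : Fin (n + 2) → ZMod 2) = hammingNorm c + 2 := by
    simp only [hammingNorm_fin_cons, one_ne_zero, if_false]
    omega
  obtain ⟨c, hc, hc0, hcd⟩ := exists_hammingNorm_eq_minDist hCne
  obtain ⟨e, he, hew⟩ := exists_hammingNorm_eq_cosetWeight x C
  have hc_mem := (hmem _).2 (.inl ⟨c, hc, rfl⟩)
  have hc_ne : (Fin.cons 0 (Fin.cons 0 c) : Fin (n + 2) → ZMod 2) ≠ 0 := by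
    rwa [← hammingNorm_ne_zero_iff, hzero, hammingNorm_ne_zero_iff]
  have he_mem := (hmem _).2 (.inr ⟨e, he, rfl⟩)
  have he_ne : (Fin.cons 1 (Fin.cons 1 (x + e)) : Fin (n + 2) → ZMod 2) ≠ 0 := by
    rw [← hammingNorm_ne_zero_iff, hone]
    omega
  apply le_antisymm
  · refine le_min ?_ ?_
    · rw [← hcd, ← hzero]
      exact minDist_le hc_mem hc_ne
    · rw [← hew, ← hone]
      exact minDist_le he_mem he_ne
  · have hC₂ne : C₂ ≠ ⊥ := C₂.ne_bot_iff.2 ⟨_, hc_mem, hc_ne⟩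
    obtain ⟨z, hz, hz0, hzd⟩ := exists_hammingNorm_eq_minDist hC₂ne
    rw [← hzd]
    rcases (hmem z).1 hz with ⟨u, hu, rfl⟩ | ⟨u, hu, rfl⟩
    · rw [← hammingNorm_ne_zero_iff, hzero, hammingNorm_ne_zero_iff] at hz0
      rw [hzero]
      exact (min_le_left _ _).trans (minDist_le hu hz0)
    · rw [hone]
      exact (min_le_right _ _).trans (Nat.add_le_add_right (cosetWeight_le x hu) 2)
end

section
/- Let C be a binary linear [n,k] code with generator matrix G (rows r₁,…,r_k), let x ∈ GF(2)^n, set y_i = x·r_i, and let G₁ be the (k+1)×(n+2) matrix with first row u = (1, 0, x₁, …, x_n) and (i+1)-st rows (y_i, y_i, r_i). Let S₁ be the span of the rows of G₁ other than the first row, and C₁ the span of all rows of G₁. Then C₁ is the disjoint union of S₁ and u + S₁, every element of u + S₁ has Hamming weight 1 + wt(x + c) for some c ∈ C, and the minimum Hamming weight over u + S₁ equals 1 + min_{c∈C} wt(x + c). -/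
open Matrix

/-- Prepending a coordinate adds one to the Hamming weight exactly when it is nonzero. -/
theorem hammingNorm_cons {n : ℕ} (a : ZMod 2) (v : Fin n → ZMod 2) :
    hammingNorm (Fin.cons a v : Fin (n + 1) → ZMod 2) =
      (if a ≠ 0 then 1 else 0) + hammingNorm v := by
  simp only [hammingNorm, Finset.card_filter, Fin.sum_univ_succ, Fin.cons_zero, Fin.cons_succ]

/-- The linear map `c ↦ (x ⬝ c, x ⬝ c, c)`. -/
def prependDotTwice {n : ℕ} (x : Fin n → ZMod 2) :
    (Fin n → ZMod 2) →ₗ[ZMod 2] (Fin (n + 2) → ZMod 2) where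
  toFun c := Fin.cons (x ⬝ᵥ c) (Fin.cons (x ⬝ᵥ c) c)
  map_add' a b := by
    ext j
    refine Fin.cases ?_ (fun j => Fin.cases ?_ (fun j => ?_) j) j <;> simp [dotProduct_add]
  map_smul' a b := by
    ext j
    refine Fin.cases ?_ (fun j => Fin.cases ?_ (fun j => ?_) j) j <;> simp [dotProduct_smul]

theorem prependDotTwice_apply {n : ℕ} (x c : Fin n → ZMod 2) :
    prependDotTwice x c = Fin.cons (x ⬝ᵥ c) (Fin.cons (x ⬝ᵥ c) c) := rfl

/-- Exactly one of the first two coordinates of `(1, 0, x) + (a, a, c)` is nonzero. -/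
theorem hammingNorm_cons_add_prependDotTwice {n : ℕ} (x c : Fin n → ZMod 2) :
    hammingNorm ((Fin.cons 1 (Fin.cons 0 x) : Fin (n + 2) → ZMod 2) + prependDotTwice x c) =
      1 + hammingNorm (x + c) := by
  have h : (Fin.cons 1 (Fin.cons 0 x) : Fin (n + 2) → ZMod 2) + prependDotTwice x c =
      Fin.cons (1 + x ⬝ᵥ c) (Fin.cons (x ⬝ᵥ c) (x + c)) := by
    ext j
    refine Fin.cases ?_ (fun j => Fin.cases ?_ (fun j => ?_) j) j <;>
      simp [prependDotTwice_apply]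
  have key : ∀ a : ZMod 2, (if 1 + a ≠ 0 then 1 else 0) + (if a ≠ 0 then 1 else 0) = 1 := by
    decide
  rw [h, hammingNorm_cons, hammingNorm_cons, ← add_assoc, key]

/-- Over `GF(2)`, the span of `u` and `S` is the union of `S` and `u + S`. -/
theorem mem_span_singleton_sup_iff {V : Type*} [AddCommGroup V] [Module (ZMod 2) V]
    (u : V) (S : Submodule (ZMod 2) V) (v : V) :
    v ∈ Submodule.span (ZMod 2) {u} ⊔ S ↔ v ∈ S ∨ ∃ s ∈ S, v = u + s := by
  rw [Submodule.mem_sup]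
  constructor
  · rintro ⟨y, hy, z, hz, rfl⟩
    obtain ⟨a, rfl⟩ := Submodule.mem_span_singleton.1 hy
    have ha : ∀ a : ZMod 2, a = 0 ∨ a = 1 := by decide
    rcases ha a with rfl | rfl
    · exact Or.inl (by simpa using hz)
    · exact Or.inr ⟨z, hz, by rw [one_smul]⟩
  · rintro (hv | ⟨s, hs, rfl⟩)
    · exact ⟨0, zero_mem _, v, hv, zero_add v⟩
    · exact ⟨u, Submodule.mem_span_singleton_self u, s, hs, rfl⟩

/-- For Construction I applied to `(G, x)`, letting `u = (1,0,x)` be the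
top row of `G₁` and `S₁` the span of the remaining rows, the code `C₁` is the disjoint
union of `S₁` and `u + S₁`; every element of `u + S₁` has Hamming weight
`1 + wt(x + c)` for some `c ∈ C`; and the minimum weight over `u + S₁` equals
`1 + min_{c ∈ C} wt(x + c)`. -/
theorem constructionI_coset_decomposition {n k : ℕ}
    (G : Matrix (Fin k) (Fin n) (ZMod 2))
    (hG : LinearIndependent (ZMod 2) (fun i => G i))
    (C : Submodule (ZMod 2) (Fin n → ZMod 2))
    (hC : C = Submodule.span (ZMod 2) (Set.range fun i => G i))
    (x : Fin n → ZMod 2)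
    (u : Fin (n + 2) → ZMod 2)
    (hu : u = Fin.cons 1 (Fin.cons 0 x))
    (G₁ : Matrix (Fin (k + 1)) (Fin (n + 2)) (ZMod 2))
    (hG₁ : G₁ = Matrix.of (Fin.cons u
      (fun i => Fin.cons (x ⬝ᵥ G i) (Fin.cons (x ⬝ᵥ G i) (G i)))))
    (S₁ : Submodule (ZMod 2) (Fin (n + 2) → ZMod 2))
    (hS₁ : S₁ = Submodule.span (ZMod 2) (Set.range fun i : Fin k => G₁ i.succ))
    (C₁ : Submodule (ZMod 2) (Fin (n + 2) → ZMod 2))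
    (hC₁ : C₁ = Submodule.span (ZMod 2) (Set.range fun i => G₁ i)) :
    (∀ v, v ∈ C₁ ↔ (v ∈ S₁ ∨ ∃ s ∈ S₁, v = u + s)) ∧
      (∀ v ∈ S₁, ∀ s ∈ S₁, v ≠ u + s) ∧
      (∀ s ∈ S₁, ∃ c ∈ C, hammingNorm (u + s) = 1 + hammingNorm (x + c)) ∧
      sInf {w | ∃ s ∈ S₁, hammingNorm (u + s) = w} = 1 + cosetWeight x C := by
  have hS : S₁ = C.map (prependDotTwice x) := by
    rw [hS₁, hC, Submodule.map_span, ← Set.range_comp, hG₁]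
    rfl
  have hC₁S₁ : C₁ = Submodule.span (ZMod 2) {u} ⊔ S₁ := by
    rw [hC₁, hS₁, ← Submodule.span_union, Fin.range_fin_succ, hG₁]
    rfl
  have hwt : ∀ c, hammingNorm (u + prependDotTwice x c) = 1 + hammingNorm (x + c) := fun c => by
    rw [hu, hammingNorm_cons_add_prependDotTwice]
  refine ⟨fun v => ?_, fun v hv s hs h => ?_, fun s hs => ?_, ?_⟩
  · rw [hC₁S₁, mem_span_singleton_sup_iff]
  · have huS : u ∈ S₁ := by
      rw [eq_sub_of_add_eq h.symm]
      exact sub_mem hv hs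
    rw [hS, hu] at huS
    obtain ⟨c, -, hc⟩ := huS
    have h0 : x ⬝ᵥ c = 1 := congrFun hc 0
    have h1 : x ⬝ᵥ c = 0 := congrFun hc 1
    exact one_ne_zero (h0.symm.trans h1)
  · rw [hS] at hs
    obtain ⟨c, hc, rfl⟩ := hs
    exact ⟨c, hc, hwt c⟩
  · apply le_antisymm
    · obtain ⟨c, hc, hw⟩ : cosetWeight x C ∈ {w | ∃ c ∈ C, hammingNorm (x + c) = w} :=
        Nat.sInf_mem (Set.nonempty_of_mem ⟨0, zero_mem C, rfl⟩)
      refine Nat.sInf_le ⟨prependDotTwice x c, ?_, by rw [hwt, hw]⟩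
      rw [hS]
      exact Submodule.mem_map_of_mem hc
    · refine le_csInf (Set.nonempty_of_mem ⟨0, zero_mem S₁, rfl⟩) ?_
      rintro w ⟨s, hs, rfl⟩
      rw [hS] at hs
      obtain ⟨c, hc, rfl⟩ := hs
      rw [hwt]
      have hle : cosetWeight x C ≤ hammingNorm (x + c) := Nat.sInf_le ⟨c, hc, rfl⟩
      exact Nat.add_le_add_left hle 1
end

section
/- Let n be even and let C be a binary self-dual [n, n/2] code (C = C⊥) with generator matrix G (rows r₁,…,r_{n/2}), and let x ∈ GF(2)^n satisfy x·x = 1. Set y_i = x·r_i and let C₁ be the code generated by the (n/2+1)×(n+2) matrix G₁ with first row (1, 0, x₁, …, x_n) and (i+1)-st rows (y_i, y_i, r_i). Then C₁ is a self-dual binary code of length n+2, i.e., C₁ = C₁⊥ and dim C₁ = n/2 + 1. -/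
open Matrix

theorem mem_dualCode_span_iff {n : ℕ} {S : Set (Fin n → ZMod 2)} {v : Fin n → ZMod 2} :
    v ∈ dualCode (Submodule.span (ZMod 2) S) ↔ ∀ c ∈ S, v ⬝ᵥ c = 0 := by
  refine ⟨fun h c hc => h c (Submodule.subset_span hc), fun h c hc => ?_⟩
  induction hc using Submodule.span_induction with
  | mem c hc => exact h c hc
  | zero => exact dotProduct_zero v
  | add a b _ _ ha hb => rw [dotProduct_add, ha, hb, add_zero]
  | smul a c _ hc => rw [dotProduct_smul, hc, smul_zero]

/-- The linear map `c ↦ (x ⬝ᵥ c, x ⬝ᵥ c, c)`. -/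
def doubledExtension {n : ℕ} (x : Fin n → ZMod 2) :
    (Fin n → ZMod 2) →ₗ[ZMod 2] (Fin (n + 2) → ZMod 2) where
  toFun c := Matrix.vecCons (x ⬝ᵥ c) (Matrix.vecCons (x ⬝ᵥ c) c)
  map_add' a b := by simp [dotProduct_add]
  map_smul' a c := by simp [dotProduct_smul]

theorem doubledExtension_apply {n : ℕ} (x c : Fin n → ZMod 2) :
    doubledExtension x c = Matrix.vecCons (x ⬝ᵥ c) (Matrix.vecCons (x ⬝ᵥ c) c) :=
  rfl

theorem doubledExtension_injective {n : ℕ} (x : Fin n → ZMod 2) :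
    Function.Injective (doubledExtension x) := by
  intro a b h
  exact congrArg (fun v => Matrix.vecTail (Matrix.vecTail v)) h

theorem doubledExtension_dotProduct_doubledExtension {n : ℕ} (x a b : Fin n → ZMod 2) :
    doubledExtension x a ⬝ᵥ doubledExtension x b = a ⬝ᵥ b := by
  simp only [doubledExtension_apply, cons_dotProduct_cons, ← add_assoc]
  rw [CharTwo.add_self_eq_zero, zero_add]

theorem vecCons_dotProduct_doubledExtension {n : ℕ} (a b : ZMod 2) (w x c : Fin n → ZMod 2) :
    Matrix.vecCons a (Matrix.vecCons b w) ⬝ᵥ doubledExtension x c = (w + (a + b) • x) ⬝ᵥ c := by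
  simp only [doubledExtension_apply, cons_dotProduct_cons, add_dotProduct, smul_dotProduct,
    smul_eq_mul]
  ring

/-- Construction I applied to a binary self-dual `[n, n/2]` code `C`
(with `x ⬝ᵥ x = 1`) produces a self-dual binary code `C₁` of length `n + 2` with
`dim C₁ = n/2 + 1`. -/
theorem constructionI_selfDual {n : ℕ} (hn : Even n)
    (G : Matrix (Fin (n / 2)) (Fin n) (ZMod 2))
    (hG : LinearIndependent (ZMod 2) (fun i => G i))
    (C : Submodule (ZMod 2) (Fin n → ZMod 2))
    (hC : C = Submodule.span (ZMod 2) (Set.range fun i => G i))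
    (hsd : C = dualCode C)
    (x : Fin n → ZMod 2) (hx : x ⬝ᵥ x = 1)
    (G₁ : Matrix (Fin (n / 2 + 1)) (Fin (n + 2)) (ZMod 2))
    (hG₁ : G₁ = Matrix.of (Fin.cons (Fin.cons 1 (Fin.cons 0 x))
      (fun i => Fin.cons (x ⬝ᵥ G i) (Fin.cons (x ⬝ᵥ G i) (G i)))))
    (C₁ : Submodule (ZMod 2) (Fin (n + 2) → ZMod 2))
    (hC₁ : C₁ = Submodule.span (ZMod 2) (Set.range fun i => G₁ i)) :
    C₁ = dualCode C₁ ∧ Module.finrank (ZMod 2) ↥C₁ = n / 2 + 1 := by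
  set r : Fin (n + 2) → ZMod 2 := Matrix.vecCons 1 (Matrix.vecCons 0 x) with hr
  have hrows : (fun i => G₁ i) = Fin.cons r (doubledExtension x ∘ fun i => G i) := by
    subst hG₁
    funext i
    refine Fin.cases rfl (fun j => rfl) i
  have hspan : Submodule.span (ZMod 2) (Set.range (doubledExtension x ∘ fun i => G i)) =
      C.map (doubledExtension x) := by
    rw [hC, Submodule.map_span, Set.range_comp]
  have hC₁' : C₁ = Submodule.span (ZMod 2) (insert r (C.map (doubledExtension x) : Set _)) := by
    rw [hC₁, hrows, Fin.range_cons, Submodule.span_insert, hspan, Submodule.span_insert,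
      Submodule.span_eq]
  constructor
  · have hrr : r ⬝ᵥ r = 0 := by
      simp only [hr, cons_dotProduct_cons, hx]
      decide
    have hrC (c : Fin n → ZMod 2) : r ⬝ᵥ doubledExtension x c = 0 := by
      rw [hr, vecCons_dotProduct_doubledExtension, add_zero, one_smul,
        ZModModule.add_self, zero_dotProduct]
    apply le_antisymm
    · rw [hC₁', Submodule.span_le]
      rintro v (rfl | ⟨c, hc, rfl⟩) <;> refine mem_dualCode_span_iff.2 ?_
      · rintro w (rfl | ⟨d, -, rfl⟩)
        exacts [hrr, hrC d]
      · rintro w (rfl | ⟨d, hd, rfl⟩)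
        · rw [dotProduct_comm, hrC]
        · rw [doubledExtension_dotProduct_doubledExtension]
          rw [hsd] at hc
          exact hc d hd
    · intro v hv
      rw [hC₁', mem_dualCode_span_iff] at hv
      obtain ⟨a, b, w, rfl⟩ : ∃ a b w, v = Matrix.vecCons a (Matrix.vecCons b w) :=
        ⟨_, _, _, by rw [cons_head_tail, cons_head_tail]⟩
      have hw : w + (a + b) • x ∈ C := by
        rw [hsd]
        intro c hc
        rw [← vecCons_dotProduct_doubledExtension]
        exact hv _ (Or.inr ⟨c, hc, rfl⟩)
      have hxw : x ⬝ᵥ w = a := by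
        have h := hv r (Or.inl rfl)
        simp only [hr, cons_dotProduct_cons, mul_one, mul_zero, zero_add] at h
        rw [dotProduct_comm, ← CharTwo.add_eq_zero, add_comm, h]
      have hxc : x ⬝ᵥ (w + (a + b) • x) = b := by
        rw [dotProduct_add, dotProduct_smul, hx, hxw, smul_eq_mul, mul_one, ← add_assoc,
          CharTwo.add_self_eq_zero, zero_add]
      have hdecomp : Matrix.vecCons a (Matrix.vecCons b w) =
          (a + b) • r + doubledExtension x (w + (a + b) • x) := by
        have hx2 : (a + b) • x + (w + (a + b) • x) = w := by
          rw [add_left_comm, ZModModule.add_self, add_zero]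
        rw [doubledExtension_apply, hxc, hr, smul_cons, smul_cons, cons_add_cons, cons_add_cons,
          hx2, smul_eq_mul, smul_eq_mul, mul_one, mul_zero, zero_add, add_assoc,
          CharTwo.add_self_eq_zero, add_zero]
      rw [hdecomp, hC₁']
      exact add_mem (Submodule.smul_mem _ _ (Submodule.subset_span (Or.inl rfl)))
        (Submodule.subset_span (Or.inr ⟨_, hw, rfl⟩))
  · have hli : LinearIndependent (ZMod 2) (fun i => G₁ i) := by
      rw [hrows, linearIndependent_finCons, hspan]
      refine ⟨hG.map' _ (LinearMap.ker_eq_bot.2 (doubledExtension_injective x)), ?_⟩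
      rintro ⟨c, -, hc⟩
      have h0 : x ⬝ᵥ c = 1 := congrFun hc 0
      have h1 : x ⬝ᵥ c = 0 := congrFun hc 1
      exact one_ne_zero (h0.symm.trans h1)
    rw [hC₁, finrank_span_eq_card hli, Fintype.card_fin]
end

section
/- Let C'' be the binary code of length 12 spanned by the rows of the 7×12 matrix over GF(2): [[1,0,0,0,0,0,0,1,1,1,0,0],[0,1,0,0,0,0,0,0,1,1,0,1],[0,0,1,0,0,0,0,1,1,0,0,1],[0,0,0,1,0,0,0,1,0,1,0,1],[0,0,0,0,1,0,0,0,1,1,1,0],[0,0,0,0,0,1,0,1,1,0,1,0],[0,0,0,0,0,0,1,1,0,1,1,0]]. Then C'' is a [12, 7, 4] binary linear code (dimension 7, minimum Hamming weight of a nonzero codeword equal to 4), and the dimension of Hull(C'') is 3. -/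
open Matrix

/-- The span of the rows of a matrix is the set of its left multiples. -/
lemma mem_span_rows_iff {m n : ℕ} (A : Matrix (Fin m) (Fin n) (ZMod 2)) (c : Fin n → ZMod 2) :
    c ∈ Submodule.span (ZMod 2) (Set.range fun i => A i) ↔ ∃ x, x ᵥ* A = c := by
  change c ∈ Submodule.span (ZMod 2) (Set.range A.row) ↔ _
  rw [← range_vecMulLinear]
  rfl

/-- A matrix with no nontrivial left kernel has row space of dimension its number of rows. -/
lemma finrank_span_rows {m n : ℕ} (A : Matrix (Fin m) (Fin n) (ZMod 2))
    (hA : ∀ x, x ᵥ* A = 0 → x = 0) :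
    Module.finrank (ZMod 2) ↥(Submodule.span (ZMod 2) (Set.range fun i => A i)) = m := by
  change Module.finrank (ZMod 2) ↥(Submodule.span (ZMod 2) (Set.range A.row)) = m
  rw [← range_vecMulLinear, LinearMap.finrank_range_of_inj, Module.finrank_fin_fun]
  exact (injective_iff_map_eq_zero A.vecMulLinear).2 hA

/-- A vector is orthogonal to the row space of a matrix iff the matrix annihilates it. -/
lemma mem_dualCode_span_rows_iff {m n : ℕ} (A : Matrix (Fin m) (Fin n) (ZMod 2))
    (v : Fin n → ZMod 2) :
    v ∈ dualCode (Submodule.span (ZMod 2) (Set.range fun i => A i)) ↔ A *ᵥ v = 0 := by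
  constructor
  · intro h
    ext i
    rw [Matrix.mulVec, dotProduct_comm]
    exact h _ (Submodule.subset_span ⟨i, rfl⟩)
  · intro h c hc
    obtain ⟨x, rfl⟩ := (mem_span_rows_iff A c).1 hc
    rw [dotProduct_comm, ← dotProduct_mulVec, h, dotProduct_zero]

/-- A generator matrix of the hull of the `[12, 7, 4]` code. -/
def hullGenerator : Matrix (Fin 3) (Fin 12) (ZMod 2) :=
  !![1,0,0,0,0,0,0,1,1,1,0,0;
     0,1,1,1,0,0,0,0,0,0,0,1;
     0,0,0,0,1,1,1,0,0,0,1,0]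

/-- The binary code `C''` of length 12 spanned by the rows of the given
`7 × 12` matrix is a `[12, 7, 4]` code (dimension 7; every nonzero codeword has
Hamming weight at least 4 and some nonzero codeword has weight exactly 4), and its
hull has dimension 3. -/
theorem code_12_7_4_hull3
    (M : Matrix (Fin 7) (Fin 12) (ZMod 2))
    (hM : M = !![1,0,0,0,0,0,0,1,1,1,0,0;
                 0,1,0,0,0,0,0,0,1,1,0,1;
                 0,0,1,0,0,0,0,1,1,0,0,1;
                 0,0,0,1,0,0,0,1,0,1,0,1;
                 0,0,0,0,1,0,0,0,1,1,1,0;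
                 0,0,0,0,0,1,0,1,1,0,1,0;
                 0,0,0,0,0,0,1,1,0,1,1,0])
    (C : Submodule (ZMod 2) (Fin 12 → ZMod 2))
    (hC : C = Submodule.span (ZMod 2) (Set.range fun i => M i)) :
    Module.finrank (ZMod 2) ↥C = 7 ∧
      (∀ c ∈ C, c ≠ 0 → 4 ≤ hammingNorm c) ∧
      (∃ c ∈ C, c ≠ 0 ∧ hammingNorm c = 4) ∧
      Module.finrank (ZMod 2) ↥(hull C) = 3 := by
  have hker : ∀ x, x ᵥ* M = 0 → x = 0 := by
    subst hM
    decide +kernel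
  have hwt : ∀ x, x ᵥ* M ≠ 0 → 4 ≤ hammingNorm (x ᵥ* M) := by
    subst hM
    decide +kernel
  have hrow : M 0 ≠ 0 ∧ hammingNorm (M 0) = 4 := by
    subst hM
    decide +kernel
  have hle : ∀ x, M *ᵥ (x ᵥ* M) = 0 →
      ![(x ᵥ* M) 0, (x ᵥ* M) 1, (x ᵥ* M) 4] ᵥ* hullGenerator = x ᵥ* M := by
    subst hM
    decide +kernel
  have hge : ∀ y : Fin 3 → ZMod 2, M *ᵥ (y ᵥ* hullGenerator) = 0 ∧
      ![y 0, y 1, y 1, y 1, y 2, y 2, y 2] ᵥ* M = y ᵥ* hullGenerator := by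
    subst hM
    decide +kernel
  have hhull : hull C = Submodule.span (ZMod 2) (Set.range fun i => hullGenerator i) := by
    ext c
    rw [hull, Submodule.mem_inf, hC, mem_dualCode_span_rows_iff, mem_span_rows_iff,
      mem_span_rows_iff]
    constructor
    · rintro ⟨⟨x, rfl⟩, h⟩
      exact ⟨_, hle x h⟩
    · rintro ⟨y, rfl⟩
      exact ⟨⟨_, (hge y).2⟩, (hge y).1⟩
  refine ⟨?_, ?_, ⟨M 0, ?_, hrow⟩, ?_⟩
  · rw [hC]
    exact finrank_span_rows M hker
  · intro c hc
    rw [hC, mem_span_rows_iff] at hc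
    obtain ⟨x, rfl⟩ := hc
    exact hwt x
  · rw [hC]
    exact Submodule.subset_span ⟨0, rfl⟩
  · rw [hhull]
    exact finrank_span_rows hullGenerator (by decide +kernel)
end
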